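/- (Linear growth of the relaxed static optimum.) Let X be a measurable space and let ℙ be a probability measure on X × (ℝ^d × ℝ^{d×m}) whose samples are written (x, r, V); assume there is M > 0 with ‖r‖ ≤ M and ‖V‖ ≤ M ℙ-almost surely. Let S ⊆ ℝ^d be nonempty, convex, and compact, let 𝒱 ⊆ ℝ^m be closed and convex with distance function d_𝒱, and let u : ℝ^m → ℝ be concave. For a measurable policy π : X → S define rew(π) := E_ℙ[rᵀπ(x)] and con(π) := E_ℙ[Vᵀπ(x)]; define OPT := sup { rew(π) + u(con(π)) : con(π) ∈ 𝒱 }, and for ε > 0 define the relaxed optimum OPT^ε := sup { rew(π) + u(con(π)) : d_𝒱(con(π)) ≤ ε }, both suprema being over measurable policies. Suppose OPT is finite and there exists a measurable policy π° with con(π°) in the interior of 𝒱. Then there exists a constant ζ_OPT ≥ 0 such that OPT^ε ≤ OPT + ζ_OPT·ε for all ε > 0. -/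

import Mathlib

open MeasureTheory Matrix

/-- The dot product of an almost surely bounded measurable vector with a measurable vector taking
values in a compact set is integrable. -/
lemma integrable_dotProduct_of_bounded {Ω ι : Type*} [MeasurableSpace Ω] [Fintype ι]
    {μ : Measure Ω} [IsFiniteMeasure μ] {M : ℝ} {g f : Ω → ι → ℝ} (hg : Measurable g)
    (hgM : ∀ᵐ ω ∂μ, ‖g ω‖ ≤ M) {S : Set (ι → ℝ)} (hS : IsCompact S) (hf : Measurable f)
    (hfS : ∀ ω, f ω ∈ S) : Integrable (fun ω => g ω ⬝ᵥ f ω) μ := by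
  obtain ⟨R, hR⟩ := hS.isBounded.exists_norm_le
  unfold dotProduct
  refine integrable_finsetSum _ fun i _ => ?_
  refine Integrable.of_bound (C := M * R) ?_ ?_
  · exact (((measurable_pi_apply i).comp hg).mul
      ((measurable_pi_apply i).comp hf)).aestronglyMeasurable
  · filter_upwards [hgM] with ω hω
    rw [norm_mul]
    exact mul_le_mul ((norm_le_pi_norm _ i).trans hω)
      ((norm_le_pi_norm _ i).trans (hR _ (hfS ω))) (norm_nonneg _) ((norm_nonneg _).trans hω)

/-- If `w` lies in a convex set containing the closed ball of radius `δ` around `v₀`, then any point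
within `ε` of `w` is pulled into the set by moving it towards `v₀` with weight `ε / (ε + δ)`. -/
lemma Convex.combo_mem_of_closedBall_subset {E : Type*} [NormedAddCommGroup E] [NormedSpace ℝ E]
    {s : Set E} (hs : Convex ℝ s) {v₀ w c : E} {δ ε : ℝ} (hδ : 0 < δ) (hε : 0 < ε)
    (hball : Metric.closedBall v₀ δ ⊆ s) (hw : w ∈ s) (hc : dist c w ≤ ε) :
    (δ / (ε + δ)) • c + (ε / (ε + δ)) • v₀ ∈ s := by
  have hpull : v₀ + (δ / ε) • (c - w) ∈ s := by
    apply hball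
    rw [mem_closedBall_iff_norm, add_sub_cancel_left, norm_smul, Real.norm_of_nonneg (by positivity),
      ← dist_eq_norm]
    calc δ / ε * dist c w ≤ δ / ε * ε := by gcongr
      _ = δ := by field_simp
  have hcombo := hs hw hpull (a := δ / (ε + δ)) (b := ε / (ε + δ)) (by positivity) (by positivity)
    (by field_simp; ring)
  convert hcombo using 1
  rw [smul_add, smul_smul, show ε / (ε + δ) * (δ / ε) = δ / (ε + δ) by field_simp, smul_sub]
  abel

/-- Linear growth of the relaxed static optimum (Assumption `opt-relax` holds under a
Slater condition): if `OPT` is finite and some policy has expected consumption in the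
interior of `𝒱`, then there is `ζ_OPT ≥ 0` with `OPT^ε ≤ OPT + ζ_OPT·ε` for all
`ε > 0`, where `OPT^ε` relaxes feasibility to `d_𝒱(con(π)) ≤ ε`. -/
theorem relaxed_optimum_linear_growth {X : Type*} [MeasurableSpace X] (d m : ℕ)
    (ℙ : Measure (X × ((Fin d → ℝ) × (Fin d → Fin m → ℝ)))) [IsProbabilityMeasure ℙ]
    (M : ℝ) (hM : 0 < M)
    (hbdd : ∀ᵐ p ∂ℙ, ‖p.2.1‖ ≤ M ∧ ‖p.2.2‖ ≤ M)
    (S : Set (Fin d → ℝ)) (hSne : S.Nonempty) (hSconv : Convex ℝ S) (hScomp : IsCompact S)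
    (𝒱 : Set (Fin m → ℝ)) (h𝒱cl : IsClosed 𝒱) (h𝒱conv : Convex ℝ 𝒱)
    (u : (Fin m → ℝ) → ℝ) (hu : ConcaveOn ℝ Set.univ u)
    (rew : (X → Fin d → ℝ) → ℝ)
    (hrew : ∀ π : X → Fin d → ℝ, rew π = ∫ p, p.2.1 ⬝ᵥ π p.1 ∂ℙ)
    (con : (X → Fin d → ℝ) → (Fin m → ℝ))
    (hcon : ∀ π : X → Fin d → ℝ, con π = ∫ p, (fun j => (fun i => p.2.2 i j) ⬝ᵥ π p.1) ∂ℙ)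
    (OPT : ℝ)
    (hOPT : OPT = sSup {z : ℝ | ∃ π : X → Fin d → ℝ, Measurable π ∧ (∀ x, π x ∈ S) ∧
      con π ∈ 𝒱 ∧ z = rew π + u (con π)})
    (hfin : BddAbove {z : ℝ | ∃ π : X → Fin d → ℝ, Measurable π ∧ (∀ x, π x ∈ S) ∧
      con π ∈ 𝒱 ∧ z = rew π + u (con π)})
    (π₀ : X → Fin d → ℝ) (hπ₀meas : Measurable π₀) (hπ₀S : ∀ x, π₀ x ∈ S)
    (hπ₀int : con π₀ ∈ interior 𝒱) :
    ∃ ζOPT : ℝ, 0 ≤ ζOPT ∧ ∀ ε : ℝ, 0 < ε →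
      sSup {z : ℝ | ∃ π : X → Fin d → ℝ, Measurable π ∧ (∀ x, π x ∈ S) ∧
        Metric.infDist (con π) 𝒱 ≤ ε ∧ z = rew π + u (con π)} ≤ OPT + ζOPT * ε := by
  have hrewInt : ∀ π : X → Fin d → ℝ, Measurable π → (∀ x, π x ∈ S) →
      Integrable (fun p : X × ((Fin d → ℝ) × (Fin d → Fin m → ℝ)) => p.2.1 ⬝ᵥ π p.1) ℙ :=
    fun π hπ hπS => integrable_dotProduct_of_bounded (by fun_prop)
      (hbdd.mono fun p hp => hp.1) hScomp (hπ.comp measurable_fst) fun p => hπS p.1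
  have hconInt : ∀ π : X → Fin d → ℝ, Measurable π → (∀ x, π x ∈ S) →
      Integrable (fun (p : X × ((Fin d → ℝ) × (Fin d → Fin m → ℝ))) (j : Fin m) =>
        (fun i => p.2.2 i j) ⬝ᵥ π p.1) ℙ := by
    intro π hπ hπS
    refine Integrable.of_eval fun j => ?_
    refine integrable_dotProduct_of_bounded (M := M) (by fun_prop) ?_ hScomp
      (hπ.comp measurable_fst) fun p => hπS p.1
    filter_upwards [hbdd] with p hp
    exact (pi_norm_le_iff_of_nonneg hM.le).2 fun i =>
      (norm_le_pi_norm _ j).trans ((norm_le_pi_norm _ i).trans hp.2)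
  obtain ⟨δ, hδ, hball⟩ :=
    Metric.nhds_basis_closedBall.mem_iff.1 (mem_interior_iff_mem_nhds.1 hπ₀int)
  have hle : ∀ π : X → Fin d → ℝ, Measurable π → (∀ x, π x ∈ S) → con π ∈ 𝒱 →
      rew π + u (con π) ≤ OPT := fun π hπ hπS hπ𝒱 =>
    hOPT ▸ le_csSup hfin ⟨π, hπ, hπS, hπ𝒱, rfl⟩
  have hπ₀𝒱 : con π₀ ∈ 𝒱 := interior_subset hπ₀int
  refine ⟨(OPT - (rew π₀ + u (con π₀))) / δ,
    div_nonneg (sub_nonneg.2 (hle π₀ hπ₀meas hπ₀S hπ₀𝒱)) hδ.le, fun ε hε => ?_⟩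
  refine csSup_le ⟨_, π₀, hπ₀meas, hπ₀S, by
    rw [Metric.infDist_zero_of_mem hπ₀𝒱]; exact hε.le, rfl⟩ ?_
  rintro z ⟨π, hπ, hπS, hdist, rfl⟩
  obtain ⟨w, hw, hwdist⟩ := h𝒱cl.exists_infDist_eq_dist ⟨_, hπ₀𝒱⟩ (con π)
  set a : ℝ := δ / (ε + δ) with ha
  set b : ℝ := ε / (ε + δ) with hb
  have ha0 : 0 ≤ a := by positivity
  have hb0 : 0 ≤ b := by positivity
  have hab : a + b = 1 := by rw [ha, hb]; field_simp; ring
  have hrewMix : rew (fun x => a • π x + b • π₀ x) = a * rew π + b * rew π₀ := by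
    rw [hrew, hrew π, hrew π₀, ← integral_const_mul, ← integral_const_mul,
      ← integral_add ((hrewInt π hπ hπS).const_mul a) ((hrewInt π₀ hπ₀meas hπ₀S).const_mul b)]
    simp only [dotProduct_add, dotProduct_smul, smul_eq_mul]
  have hconMix : con (fun x => a • π x + b • π₀ x) = a • con π + b • con π₀ := by
    rw [hcon, hcon π, hcon π₀, ← integral_smul, ← integral_smul,
      ← integral_add ((hconInt π hπ hπS).fun_smul a) ((hconInt π₀ hπ₀meas hπ₀S).fun_smul b)]
    congr 1
    ext p j
    simp only [dotProduct_add, dotProduct_smul, Pi.add_apply, Pi.smul_apply]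
  have hmix := hle (fun x => a • π x + b • π₀ x) ((hπ.const_smul a).add (hπ₀meas.const_smul b))
    (fun x => hSconv (hπS x) (hπ₀S x) ha0 hb0 hab)
    (hconMix ▸ h𝒱conv.combo_mem_of_closedBall_subset hδ hε hball hw (hwdist ▸ hdist))
  have hconc := hu.2 (Set.mem_univ (con π)) (Set.mem_univ (con π₀)) ha0 hb0 hab
  rw [hrewMix, hconMix] at hmix
  simp only [smul_eq_mul] at hconc
  have hval : a * (rew π + u (con π)) + b * (rew π₀ + u (con π₀)) ≤ OPT := by linarith
  have hscaled : δ * (rew π + u (con π)) + ε * (rew π₀ + u (con π₀)) ≤ OPT * (ε + δ) := by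
    rw [← div_le_iff₀ (by positivity)]
    refine le_of_eq_of_le ?_ hval
    rw [ha, hb]
    ring
  rw [div_mul_eq_mul_div, ← sub_le_iff_le_add', le_div_iff₀ hδ]
  linarith
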